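/- arXiv:2506.16793 — 3 statements merged into one kernel-verified Lean document; each statement's English description precedes it below -/
import Mathlib

section
/- Let C be an [n, k] linear code over F_q. Then C is near-MDS if and only if every generator matrix G of C satisfies: (i) any k−1 columns of G are linearly independent, (ii) some set of k columns of G is linearly dependent, and (iii) any k+1 columns of G have rank k. -/
section GeneratorMatrix

variable {ι κ F : Type*} [Field F]

/-- A vector is orthogonal to the row space of `G` iff `G` annihilates it. -/
theorem forall_mem_span_rows_sum_mul_eq_zero_iff [Fintype ι]
    {G : Matrix κ ι F} {C : Submodule F (ι → F)}
    (hG : Submodule.span F (Set.range fun i => G i) = C) (u : ι → F) :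
    (∀ c ∈ C, ∑ i, u i * c i = 0) ↔ G.mulVec u = 0 := by
  subst hG
  constructor
  · intro h
    ext i
    have := h (G i) (Submodule.subset_span ⟨i, rfl⟩)
    simpa [Matrix.mulVec, dotProduct, mul_comm] using this
  · intro h c hc
    induction hc using Submodule.span_induction with
    | mem x hx =>
      obtain ⟨i, rfl⟩ := hx
      simpa [Matrix.mulVec, dotProduct, mul_comm] using congrFun h i
    | zero => simp
    | add x y _ _ hx hy => simp [mul_add, Finset.sum_add_distrib, hx, hy]
    | smul a x _ hx =>
      simp only [Pi.smul_apply, smul_eq_mul, mul_left_comm, ← Finset.mul_sum, hx, mul_zero]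

/-- The columns of `G` indexed by `s` are independent iff the only dual codeword supported in `s`
is zero. -/
theorem linearIndependent_columns_iff [Fintype ι]
    {G : Matrix κ ι F} {C : Submodule F (ι → F)}
    (hG : Submodule.span F (Set.range fun i => G i) = C) (s : Finset ι) :
    LinearIndependent F (fun j : s => fun i => G i j.1) ↔
      ∀ u : ι → F, (∀ c ∈ C, ∑ i, u i * c i = 0) → (∀ j ∉ s, u j = 0) → u = 0 := by
  classical
  simp only [forall_mem_span_rows_sum_mul_eq_zero_iff hG]
  change LinearIndepOn F (fun j i => G i j) (s : Set ι) ↔ _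
  rw [linearIndepOn_finset_iff]
  have key (u : ι → F) (hu : ∀ j ∉ s, u j = 0) :
      ∑ j ∈ s, u j • (fun i => G i j) = G.mulVec u := by
    rw [Finset.sum_subset s.subset_univ fun j _ hj => by simp [hu j hj]]
    ext i
    simp [Matrix.mulVec, dotProduct, mul_comm]
  constructor
  · intro h u hu hs
    ext j
    by_cases hj : j ∈ s
    · exact h u ((key u hs).trans hu) j hj
    · exact hs j hj
  · intro h g hg j hj
    have hs : ∀ j ∉ s, (if j ∈ s then g j else 0) = 0 := fun j hj => if_neg hj
    have := h (fun j => if j ∈ s then g j else 0) ?_ hs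
    · simpa [hj] using congrFun this j
    · rw [← key _ hs, ← hg]
      exact Finset.sum_congr rfl fun j hj => by rw [if_pos hj]

/-- The columns of `G` indexed by `s` have full rank iff the only codeword vanishing on `s`
is zero. -/
theorem finrank_span_columns_eq_card_iff [Fintype κ]
    {G : Matrix κ ι F} {C : Submodule F (ι → F)}
    (hli : LinearIndependent F fun i => G i)
    (hG : Submodule.span F (Set.range fun i => G i) = C) (s : Finset ι) :
    Module.finrank F (Submodule.span F (Set.range (fun j : s => fun i => G i j.1))) =
        Fintype.card κ ↔
      ∀ c ∈ C, (∀ j ∈ s, c j = 0) → c = 0 := by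
  let A : Matrix κ s F := G.submatrix id Subtype.val
  have hrank : Module.finrank F (Submodule.span F (Set.range (fun j : s => fun i => G i j.1))) =
      Module.finrank F (Submodule.span F (Set.range A.row)) := by
    rw [← Matrix.rank_eq_finrank_span_row A, Matrix.rank_eq_finrank_span_cols]
    rfl
  rw [hrank, eq_comm]
  change _ = Set.finrank F _ ↔ _
  rw [← linearIndependent_iff_card_eq_finrank_span, Fintype.linearIndependent_iff]
  have hA (x : κ → F) : ∑ i, x i • A.row i = 0 ↔ ∀ j ∈ s, (∑ i, x i • G i) j = 0 := by
    simp [funext_iff, A, Matrix.row]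
  simp only [hA]
  rw [Fintype.linearIndependent_iff] at hli
  subst hG
  constructor
  · intro h c hc hs
    obtain ⟨x, rfl⟩ := (Submodule.mem_span_range_iff_exists_fun F).1 hc
    simp [h x hs]
  · intro h x hx
    exact hli x (h _ ((Submodule.mem_span_range_iff_exists_fun F).2 ⟨x, rfl⟩) hx)

theorem forall_card_linearIndependent_columns_iff [Fintype ι] [DecidableEq F]
    {G : Matrix κ ι F} {C : Submodule F (ι → F)}
    (hG : Submodule.span F (Set.range fun i => G i) = C) {m : ℕ} (hm : m ≤ Fintype.card ι) :
    (∀ s : Finset ι, s.card = m → LinearIndependent F (fun j : s => fun i => G i j.1)) ↔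
      ∀ u : ι → F, (∀ c ∈ C, ∑ i, u i * c i = 0) → u ≠ 0 → m < hammingNorm u := by
  simp only [linearIndependent_columns_iff hG]
  constructor
  · intro h u hu hne
    by_contra! hlt
    obtain ⟨s, hs, hcard⟩ := Finset.exists_superset_card_eq hlt hm
    refine hne (h s hcard u hu fun j hj => ?_)
    by_contra hj0
    exact hj (hs (by simpa using hj0))
  · intro h s hs u hu hsupp
    by_contra hne
    refine (h u hu hne).not_ge (hs ▸ Finset.card_le_card fun j hj => ?_)
    by_contra hjs
    exact (Finset.mem_filter.1 hj).2 (hsupp j hjs)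

theorem forall_card_finrank_span_columns_iff [Fintype ι] [Fintype κ] [DecidableEq F]
    {G : Matrix κ ι F} {C : Submodule F (ι → F)}
    (hli : LinearIndependent F fun i => G i)
    (hG : Submodule.span F (Set.range fun i => G i) = C) (m : ℕ) :
    (∀ s : Finset ι, s.card = m →
        Module.finrank F (Submodule.span F (Set.range (fun j : s => fun i => G i j.1))) =
          Fintype.card κ) ↔
      ∀ c ∈ C, c ≠ 0 → Fintype.card ι < hammingNorm c + m := by
  classical
  simp only [finrank_span_columns_eq_card_iff hli hG]
  have hcard (c : ι → F) :
      (Finset.univ.filter fun i => c i = 0).card + hammingNorm c = Fintype.card ι :=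
    Finset.card_filter_add_card_filter_not _
  constructor
  · intro h c hc hne
    by_contra! hlt
    obtain ⟨s, hs, hsm⟩ := Finset.exists_subset_card_eq
      (show m ≤ (Finset.univ.filter fun i => c i = 0).card by have := hcard c; omega)
    exact hne (h s hsm c hc fun j hj => (Finset.mem_filter.1 (hs hj)).2)
  · intro h s hs c hc hzero
    by_contra hne
    have hle : s.card ≤ (Finset.univ.filter fun i => c i = 0).card :=
      Finset.card_le_card fun j hj => by simpa using hzero j hj
    have := h c hc hne
    have := hcard c
    omega

end GeneratorMatrix


/-- Generator-matrix characterization of near-MDS codes: an [n, k] code C is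
near-MDS (minimum distance n−k and dual minimum distance k) iff every generator
matrix G of C satisfies: (i) any k−1 columns are linearly independent,
(ii) some k columns are linearly dependent, (iii) any k+1 columns have rank k. -/
theorem stmt_6 (n k : ℕ) (F : Type) [Field F] [Fintype F] [DecidableEq F]
    (C : Submodule F (Fin n → F)) (hdim : Module.finrank F C = k)
    (hk : 1 ≤ k) (hkn : k + 1 ≤ n) :
    ((∀ c ∈ C, c ≠ 0 → n - k ≤ hammingNorm c) ∧
     (∃ c ∈ C, c ≠ 0 ∧ hammingNorm c = n - k) ∧
     (∀ u : Fin n → F, (∀ c ∈ C, ∑ i, u i * c i = 0) → u ≠ 0 →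
        k ≤ hammingNorm u) ∧
     (∃ u : Fin n → F, (∀ c ∈ C, ∑ i, u i * c i = 0) ∧ u ≠ 0 ∧
        hammingNorm u = k))
    ↔
    (∀ G : Matrix (Fin k) (Fin n) F,
      LinearIndependent F (fun i : Fin k => G i) →
      Submodule.span F (Set.range (fun i : Fin k => G i)) = C →
      ((∀ s : Finset (Fin n), s.card = k - 1 →
          LinearIndependent F (fun j : s => fun i : Fin k => G i j.1)) ∧
       (∃ s : Finset (Fin n), s.card = k ∧
          ¬ LinearIndependent F (fun j : s => fun i : Fin k => G i j.1)) ∧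
       (∀ s : Finset (Fin n), s.card = k + 1 →
          Module.finrank F
            (Submodule.span F (Set.range (fun j : s => fun i : Fin k => G i j.1)))
            = k))) := by
  have column_conditions (G : Matrix (Fin k) (Fin n) F) (hli : LinearIndependent F fun i => G i)
      (hG : Submodule.span F (Set.range fun i => G i) = C) := And.intro
    (forall_card_linearIndependent_columns_iff hG (m := k - 1) (by simp; omega)) <| And.intro
    (forall_card_linearIndependent_columns_iff hG (m := k) (by simp; omega)) <| And.intro
    (forall_card_finrank_span_columns_iff hli hG k)
    (forall_card_finrank_span_columns_iff hli hG (k + 1))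
  simp only [Fintype.card_fin] at column_conditions
  constructor
  · rintro ⟨hmin, -, hdual, u, hu, hu0, huk⟩ G hli hG
    obtain ⟨h₁, h₂, -, h₄⟩ := column_conditions G hli hG
    refine ⟨h₁.2 fun v hv hv0 => ?_, ?_, h₄.2 fun c hc hc0 => ?_⟩
    · have := hdual v hv hv0
      omega
    · by_contra! h
      exact (h₂.1 h u hu hu0).ne' huk
    · have := hmin c hc hc0
      omega
  · intro h
    let b := Module.finBasisOfFinrankEq F C hdim
    let G : Matrix (Fin k) (Fin n) F := fun i => (b i : Fin n → F)
    have hli : LinearIndependent F fun i => G i :=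
      b.linearIndependent.map' C.subtype C.ker_subtype
    have hG : Submodule.span F (Set.range fun i => G i) = C := by
      have := congrArg (Submodule.map C.subtype) b.span_eq
      rwa [Submodule.map_span, ← Set.range_comp, Submodule.map_top, Submodule.range_subtype] at this
    obtain ⟨h₁, h₂, h₃, h₄⟩ := column_conditions G hli hG
    obtain ⟨hi, ⟨s, hs, hdep⟩, hiii⟩ := h G hli hG
    have hmin : ∀ c ∈ C, c ≠ 0 → n - k ≤ hammingNorm c := fun c hc hc0 => by
      have := h₄.1 hiii c hc hc0
      omega
    have hdual : ∀ u : Fin n → F, (∀ c ∈ C, ∑ i, u i * c i = 0) → u ≠ 0 →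
        k ≤ hammingNorm u := fun u hu hu0 => by
      have := h₁.1 hi u hu hu0
      omega
    refine ⟨hmin, ?_, hdual, ?_⟩
    · have hrank := mt h₃.2 fun hfull => hdep <| by
        rw [linearIndependent_iff_card_eq_finrank_span, Fintype.card_coe, hs]
        exact (hfull s hs).symm
      push Not at hrank
      obtain ⟨c, hc, hc0, hle⟩ := hrank
      exact ⟨c, hc, hc0, le_antisymm (by omega) (hmin c hc hc0)⟩
    · have hind := mt h₂.2 fun hfull => hdep (hfull s hs)
      push Not at hind
      obtain ⟨u, hu, hu0, hle⟩ := hind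
      exact ⟨u, hu, hu0, le_antisymm hle (hdual u hu hu0)⟩
end

section
/- Let C be an [n, k, n−k] near-MDS code over F_q. Then the number of minimum-weight codewords of C equals the number of minimum-weight codewords of its dual: A_{n−k} = A⊥_k. -/
/-- The vectors in `ι → F` that vanish outside `S`. -/
def supportedOn {ι : Type*} (F : Type*) [Field F] (S : Finset ι) : Submodule F (ι → F) :=
  ⨅ i ∈ (S : Set ι)ᶜ, LinearMap.ker (LinearMap.proj i : (ι → F) →ₗ[F] F)

theorem mem_supportedOn {ι F : Type*} [Field F] {S : Finset ι} {x : ι → F} :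
    x ∈ supportedOn F S ↔ ∀ i, i ∉ S → x i = 0 := by
  simp [supportedOn, Submodule.mem_iInf]

theorem finrank_supportedOn {ι F : Type*} [Field F] [DecidableEq ι] (S : Finset ι) :
    Module.finrank F (supportedOn F S) = S.card := by
  have e := LinearMap.iInfKerProjEquiv F (fun _ : ι => F) (I := (S : Set ι)) (J := (S : Set ι)ᶜ)
    disjoint_compl_right (by simp)
  rw [supportedOn, e.finrank_eq]
  simp

/-- The orthogonal complement of a code for the standard dot product. -/
def dualCode {ι F : Type*} [Fintype ι] [Field F] (C : Submodule F (ι → F)) :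
    Submodule F (ι → F) :=
  LinearMap.BilinForm.orthogonal (dotProductBilin F F) C

theorem mem_dualCode {ι F : Type*} [Fintype ι] [Field F] {C : Submodule F (ι → F)}
    {u : ι → F} : u ∈ dualCode C ↔ ∀ c ∈ C, ∑ i, u i * c i = 0 := by
  simp only [dualCode, LinearMap.BilinForm.mem_orthogonal_iff]
  refine forall₂_congr fun c _ => ?_
  change ∑ i, c i * u i = 0 ↔ _
  simp only [mul_comm]

theorem finrank_dualCode {ι F : Type*} [Fintype ι] [Field F] (C : Submodule F (ι → F)) :
    Module.finrank F (dualCode C) = Fintype.card ι - Module.finrank F C := by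
  have h : LinearMap.BilinForm.Nondegenerate (dotProductBilin F F : LinearMap.BilinForm F (ι → F)) :=
    ⟨fun v hv => dotProduct_eq_zero v hv,
      fun v hv => dotProduct_eq_zero v fun w => (dotProduct_comm v w).trans (hv w)⟩
  rw [dualCode, LinearMap.BilinForm.finrank_orthogonal h, Module.finrank_fintype_fun_eq_card]

theorem dualCode_sup_supportedOn {ι F : Type*} [Fintype ι] [DecidableEq ι] [Field F]
    (C : Submodule F (ι → F)) (S : Finset ι) :
    dualCode (C ⊔ supportedOn F S) = dualCode C ⊓ supportedOn F Sᶜ := by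
  ext u
  simp only [Submodule.mem_inf, mem_dualCode, mem_supportedOn, Finset.mem_compl, not_not]
  constructor
  · refine fun h => ⟨fun c hc => h c (Submodule.mem_sup_left hc), fun i hi => ?_⟩
    have := h (Pi.single i 1) (Submodule.mem_sup_right (mem_supportedOn.2 fun j hj =>
      Pi.single_eq_of_ne (by rintro rfl; exact hj hi) _))
    simpa [Pi.single_apply] using this
  · rintro ⟨hC, hS⟩ c hc
    obtain ⟨x, hx, y, hy, rfl⟩ := Submodule.mem_sup.1 hc
    simp only [Pi.add_apply, mul_add, Finset.sum_add_distrib, hC x hx, zero_add]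
    refine Finset.sum_eq_zero fun i _ => ?_
    by_cases hi : i ∈ S
    · rw [hS i hi, zero_mul]
    · rw [mem_supportedOn.1 hy i hi, mul_zero]

/-- If `S` has complementary size to the dimension of `C`, then the codewords of `C` supported on
`S` and the dual codewords supported on the complement of `S` form spaces of equal dimension. -/
theorem finrank_inf_supportedOn_eq {ι F : Type*} [Fintype ι] [DecidableEq ι] [Field F]
    (C : Submodule F (ι → F)) (S : Finset ι)
    (hS : Module.finrank F C + S.card = Fintype.card ι) :
    Module.finrank F ↥(C ⊓ supportedOn F S) =
      Module.finrank F ↥(dualCode C ⊓ supportedOn F Sᶜ) := by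
  have h := Submodule.finrank_sup_add_finrank_inf_eq C (supportedOn F S)
  rw [finrank_supportedOn] at h
  rw [← dualCode_sup_supportedOn, finrank_dualCode]
  omega

/-- If the dimensions of the subcodes supported on complementary sets of sizes `a` and `b` agree,
and `D` has minimum distance at least `b`, then `C` has at most as many words of weight `a` as `D`
has of weight `b`. -/
theorem card_hammingNorm_eq_le {ι F : Type*} [Fintype ι] [DecidableEq ι] [Field F] [Fintype F]
    [DecidableEq F] (C D : Submodule F (ι → F)) {a b : ℕ} (ha : 1 ≤ a)
    (hab : a + b = Fintype.card ι) (hD : ∀ u ∈ D, u ≠ 0 → b ≤ hammingNorm u)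
    (h : ∀ S : Finset ι, S.card = a → Module.finrank F ↥(C ⊓ supportedOn F S) =
      Module.finrank F ↥(D ⊓ supportedOn F Sᶜ)) :
    Nat.card {c : ι → F // c ∈ C ∧ hammingNorm c = a} ≤
      Nat.card {u : ι → F // u ∈ D ∧ hammingNorm u = b} := by
  have key : ∀ S : Finset ι, ∃ g : (ι → F) →ₗ[F] (ι → F), S.card = a →
      (∀ x ∈ C ⊓ supportedOn F S, g x ∈ D ⊓ supportedOn F Sᶜ) ∧
      (∀ x ∈ C ⊓ supportedOn F S, ∀ y ∈ C ⊓ supportedOn F S, g x = g y → x = y) := by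
    intro S
    by_cases hS : S.card = a
    · let e := LinearEquiv.ofFinrankEq _ _ (h S hS)
      obtain ⟨g, hg⟩ := LinearMap.exists_extend
        ((D ⊓ supportedOn F Sᶜ).subtype ∘ₗ e.toLinearMap)
      have hg' : ∀ x (hx : x ∈ C ⊓ supportedOn F S), g x = e ⟨x, hx⟩ :=
        fun x hx => LinearMap.congr_fun hg ⟨x, hx⟩
      refine ⟨g, fun _ => ⟨fun x hx => ?_, fun x hx y hy hxy => ?_⟩⟩
      · rw [hg' x hx]
        exact (e ⟨x, hx⟩).2
      · rw [hg' x hx, hg' y hy] at hxy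
        exact congrArg Subtype.val (e.injective (Subtype.ext hxy))
    · exact ⟨0, fun h => absurd h hS⟩
  choose g hg using key
  let supp : (ι → F) → Finset ι := fun c => {i | c i ≠ 0}
  have hsupp : ∀ c ∈ C, c ∈ C ⊓ supportedOn F (supp c) := fun c hc =>
    ⟨hc, mem_supportedOn.2 fun i hi => by simpa [supp] using hi⟩
  have hcompl : ∀ c ∈ C, hammingNorm c = a →
      hammingNorm (g (supp c) c) = b ∧ supp (g (supp c) c) = (supp c)ᶜ := by
    intro c hc hca
    have hcard : (supp c).card = a := hca
    obtain ⟨hmaps, hinj⟩ := hg (supp c) hcard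
    have hmem := hmaps c (hsupp c hc)
    have hne : g (supp c) c ≠ 0 := by
      intro h0
      have : c = 0 := hinj c (hsupp c hc) 0 (zero_mem _) (h0.trans (map_zero _).symm)
      rw [this, hammingNorm_zero] at hca
      omega
    have hle : supp (g (supp c) c) ⊆ (supp c)ᶜ := by
      intro i hi
      by_contra hic
      exact (Finset.mem_filter.1 hi).2 (mem_supportedOn.1 hmem.2 i hic)
    have hbc : (supp c)ᶜ.card = b := by
      rw [Finset.card_compl]
      omega
    have hge : b ≤ (supp (g (supp c) c)).card := hD _ hmem.1 hne
    have heq := Finset.eq_of_subset_of_card_le hle (hbc.le.trans hge)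
    exact ⟨(congrArg Finset.card heq).trans hbc, heq⟩
  refine Nat.card_le_card_of_injective
    (fun c => ⟨g (supp c.1) c.1,
      ((hg (supp c.1) c.2.2).1 c.1 (hsupp c.1 c.2.1)).1, (hcompl c.1 c.2.1 c.2.2).1⟩) ?_
  rintro ⟨c, hc, hca⟩ ⟨d, hd, hda⟩ hcd
  have hcd' : g (supp c) c = g (supp d) d := congrArg Subtype.val hcd
  have hs : supp c = supp d := by
    rw [← compl_inj_iff, ← (hcompl c hc hca).2, ← (hcompl d hd hda).2, hcd']
  refine Subtype.ext ((hg (supp c) hca).2 c (hsupp c hc) d (hs ▸ hsupp d hd) ?_)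
  rw [hcd', hs]


/-- A near-MDS [n, k, n−k] code and its dual have the same number of
minimum-weight codewords: A_{n−k} = A⊥_k. -/
theorem stmt_8 (n k : ℕ) (F : Type) [Field F] [Fintype F] [DecidableEq F]
    (C : Submodule F (Fin n → F))
    (hdim : Module.finrank F C = k)
    (hk : 1 ≤ k) (hkn : k ≤ n)
    (hd1 : ∀ c ∈ C, c ≠ 0 → n - k ≤ hammingNorm c)
    (hd2 : ∃ c ∈ C, c ≠ 0 ∧ hammingNorm c = n - k)
    (hdual1 : ∀ u : Fin n → F, (∀ c ∈ C, ∑ i, u i * c i = 0) → u ≠ 0 →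
      k ≤ hammingNorm u)
    (hdual2 : ∃ u : Fin n → F, (∀ c ∈ C, ∑ i, u i * c i = 0) ∧ u ≠ 0 ∧
      hammingNorm u = k) :
    Nat.card {c : Fin n → F // c ∈ C ∧ hammingNorm c = n - k}
      = Nat.card {u : Fin n → F //
          (∀ c ∈ C, ∑ i, u i * c i = 0) ∧ hammingNorm u = k} := by
  have hlt : 1 ≤ n - k := by
    obtain ⟨c, -, hc0, hc⟩ := hd2
    have := hammingNorm_pos_iff.2 hc0
    omega
  have hfin (S : Finset (Fin n)) (hS : S.card = n - k) :=
    finrank_inf_supportedOn_eq C S (by rw [hdim, hS, Fintype.card_fin]; omega)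
  simp only [← mem_dualCode] at hdual1 ⊢
  apply le_antisymm
  · exact card_hammingNorm_eq_le C (dualCode C) hlt (by rw [Fintype.card_fin]; omega) hdual1 hfin
  · refine card_hammingNorm_eq_le (dualCode C) C hk (by rw [Fintype.card_fin]; omega) hd1
      fun S hS => ?_
    rw [hfin Sᶜ (by rw [Finset.card_compl, hS, Fintype.card_fin]), compl_compl]
end

section
/- Let G be a finite abelian group of order n. For any x ∈ G and 1 ≤ k ≤ n, the number b_k^x of k-subsets T of G with Σ_{t∈T} t = x is given by b_k^x = (1/n) Σ_{s | gcd(exp(G), k)} (−1)^{k + k/s} C(n/s, k/s) Σ_{d | gcd(e(x), s)} μ(s/d) · |G[d]|, where exp(G) is the exponent of G, e(x) = max{d : d | exp(G), x ∈ dG}, G[d] is the d-torsion subgroup, and μ is the Möbius function. -/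
open Finset Polynomial

section SubsetSum

variable {G : Type*} [AddCommGroup G]

/-- The subgroups `dG` are closed under intersections, with `aG ∩ bG = lcm(a, b)G`. -/
lemma exists_lcm_nsmul_eq {a b : ℕ} (ha : 0 < a) {x : G}
    (hxa : ∃ g : G, a • g = x) (hxb : ∃ g : G, b • g = x) :
    ∃ g : G, Nat.lcm a b • g = x := by
  obtain ⟨g, hg⟩ := hxa
  obtain ⟨h, hh⟩ := hxb
  obtain ⟨t, u, v, -, huv, rfl, rfl⟩ := Nat.exists_coprime' (Nat.gcd_pos_of_pos_left b ha)
  have hbez : (u : ℤ) * u.gcdA v + v * u.gcdB v = 1 := by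
    rw [← Nat.gcd_eq_gcd_ab, huv.gcd_eq_one, Nat.cast_one]
  refine ⟨u.gcdA v • h + u.gcdB v • g, ?_⟩
  rw [Nat.lcm_mul_right, huv.lcm_eq_mul, ← natCast_zsmul]
  rw [← natCast_zsmul] at hg hh
  calc ((u * v * t : ℕ) : ℤ) • (u.gcdA v • h + u.gcdB v • g)
      = ((u : ℤ) * u.gcdA v) • (((v * t : ℕ) : ℤ) • h)
        + ((v : ℤ) * u.gcdB v) • (((u * t : ℕ) : ℤ) • g) := by
        push_cast
        module
    _ = x := by rw [hg, hh, ← add_smul, hbez, one_smul]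

/-- Among the divisors `d` of `N`, the largest one with `x ∈ dG` is a multiple of all others. -/
lemma dvd_sup_divisors_filter_iff {N d : ℕ} (hN : N ≠ 0) (hd : d ∣ N) (x : G)
    [DecidablePred fun d : ℕ => ∃ g : G, d • g = x] :
    d ∣ (N.divisors.filter (fun d => ∃ g : G, d • g = x)).sup id ↔ ∃ g : G, d • g = x := by
  set A := N.divisors.filter (fun d => ∃ g : G, d • g = x) with hA
  have hne : A.Nonempty := ⟨1, by simp [hA, hN]⟩
  obtain ⟨e, he, hsup⟩ := A.exists_mem_eq_sup hne id
  rw [hsup, id]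
  have he' := he
  simp only [hA, mem_filter, Nat.mem_divisors] at he'
  constructor
  · rintro ⟨c, rfl⟩
    obtain ⟨g, hg⟩ := he'.2
    exact ⟨c • g, by rw [smul_smul, hg]⟩
  · intro hx
    have hdpos : 0 < d := Nat.pos_of_dvd_of_pos hd (Nat.pos_of_ne_zero hN)
    have hmem : Nat.lcm d e ∈ A := by
      simp only [hA, mem_filter, Nat.mem_divisors]
      exact ⟨⟨Nat.lcm_dvd hd he'.1.1, hN⟩, exists_lcm_nsmul_eq hdpos hx he'.2⟩
    have hle : Nat.lcm d e ≤ e := by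
      have := le_sup (f := id) hmem
      rwa [hsup] at this
    have hepos : 0 < e := Nat.pos_of_dvd_of_pos he'.1.1 (Nat.pos_of_ne_zero hN)
    have heq : Nat.lcm d e = e :=
      le_antisymm hle (Nat.le_of_dvd (Nat.lcm_pos hdpos hepos) (Nat.dvd_lcm_right d e))
    exact heq ▸ Nat.dvd_lcm_left d e

lemma card_nsmul_eq [Finite G] (d : ℕ) {x g₀ : G} (h : d • g₀ = x) :
    Nat.card {g : G // d • g = x} = Nat.card {g : G // d • g = 0} := by
  refine Nat.card_congr ⟨fun g => ⟨g.1 - g₀, ?_⟩, fun g => ⟨g.1 + g₀, ?_⟩, ?_, ?_⟩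
  · rw [smul_sub, g.2, h, sub_self]
  · rw [smul_add, g.2, h, zero_add]
  · intro g; simp
  · intro g; simp

lemma AddChar.orderOf_dvd_exponent (χ : AddChar G ℂ) : orderOf χ ∣ AddMonoid.exponent G := by
  refine orderOf_dvd_of_pow_eq_one (AddChar.ext _ _ fun g => ?_)
  rw [AddChar.pow_apply, ← AddChar.map_nsmul_eq_pow, AddMonoid.exponent_nsmul_eq_zero]
  simp

variable [Fintype G]

/-- The sum over the `d`-torsion characters at `x` counts the solutions of `d • g = x`. -/
lemma AddChar.sum_filter_pow_eq_one_apply_neg (d : ℕ) (x : G) :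
    ∑ χ : AddChar G ℂ with χ ^ d = 1, χ (-x) = (Nat.card {g : G // d • g = x} : ℂ) := by
  classical
  have hn : (Fintype.card G : ℂ) ≠ 0 := by simp
  have key : ∑ χ : AddChar G ℂ, ∑ g : G, χ (d • g - x)
      = ∑ g : G, ∑ χ : AddChar G ℂ, χ (d • g - x) := sum_comm
  have hl (χ : AddChar G ℂ) : ∑ g : G, χ (d • g - x)
      = (if χ ^ d = 1 then χ (-x) else 0) * (Fintype.card G : ℂ) := by
    have : ∀ g, χ (d • g - x) = χ (-x) * (χ ^ d) g := fun g => by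
      rw [sub_eq_add_neg, AddChar.map_add_eq_mul, AddChar.map_nsmul_eq_pow, AddChar.pow_apply,
        mul_comm]
    simp_rw [this]
    rw [← mul_sum, AddChar.sum_eq_ite, AddChar.one_eq_zero]
    split_ifs <;> simp
  simp_rw [hl, AddChar.sum_apply_eq_ite, sub_eq_zero] at key
  rw [← sum_mul, ← sum_filter, ← sum_filter, sum_const, nsmul_eq_mul] at key
  rw [mul_right_cancel₀ hn key, Nat.card_eq_fintype_card, Fintype.card_subtype]

/-- Möbius inversion of the torsion character sums isolates the characters of exact order `s`. -/
lemma AddChar.sum_filter_orderOf_eq_apply_neg {s : ℕ} (hs : 0 < s) (x : G) :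
    ∑ χ : AddChar G ℂ with orderOf χ = s, χ (-x)
      = ∑ d ∈ s.divisors,
        (ArithmeticFunction.moebius (s / d) : ℂ) * (Nat.card {g : G // d • g = x} : ℂ) := by
  classical
  have h := (ArithmeticFunction.sum_eq_iff_sum_mul_moebius_eq
    (f := fun s => ∑ χ : AddChar G ℂ with orderOf χ = s, χ (-x))
    (g := fun d => (Nat.card {g : G // d • g = x} : ℂ))).1 (fun n hn => by
      rw [← AddChar.sum_filter_pow_eq_one_apply_neg,
        ← sum_fiberwise_of_maps_to (s := univ.filter fun χ : AddChar G ℂ => χ ^ n = 1)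
          (t := n.divisors) (g := orderOf)]
      · refine sum_congr rfl fun i hi => sum_congr ?_ fun _ _ => rfl
        ext χ
        simp only [mem_filter, mem_univ, true_and]
        refine ⟨fun h => ⟨?_, h⟩, fun h => h.2⟩
        rw [← orderOf_dvd_iff_pow_eq_one, h]
        exact Nat.dvd_of_mem_divisors hi
      · intro χ hχ
        rw [Nat.mem_divisors, orderOf_dvd_iff_pow_eq_one]
        exact ⟨(mem_filter.1 hχ).2, hn.ne'⟩) s hs
  rw [← h]
  exact Nat.sum_divisorsAntidiagonal'
    (f := fun a b => (ArithmeticFunction.moebius a : ℂ) * (Nat.card {g : G // b • g = x} : ℂ))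

/-- A character of order `s` takes every `s`-th root of unity as a value, equally often. -/
lemma AddChar.card_fiber_mul_orderOf (χ : AddChar G ℂ) {ζ : ℂ} (hζ : ζ ^ orderOf χ = 1) :
    #{g : G | χ g = ζ} * orderOf χ = Fintype.card G := by
  classical
  have hs : 0 < orderOf χ := orderOf_pos χ
  set s := orderOf χ
  let f : Multiplicative G →* ℂˣ := χ.toMonoidHom.toHomUnits
  have hmaps : ∀ g : G, χ g ∈ nthRootsFinset s (1 : ℂ) := fun g => by
    rw [mem_nthRootsFinset hs, ← AddChar.pow_apply, pow_orderOf_eq_one, AddChar.one_apply]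
  have hcard : Nat.card f.range ≤ #(univ.image χ) := by
    have hmem (u : f.range) : ((u : ℂˣ) : ℂ) ∈ univ.image χ := by
      obtain ⟨_, g, rfl⟩ := u
      exact mem_image.2 ⟨g.toAdd, mem_univ _, rfl⟩
    rw [← Nat.card_eq_finsetCard]
    refine Nat.card_le_card_of_injective
      (fun u : f.range => (⟨_, hmem u⟩ : univ.image χ)) fun u v huv => ?_
    exact Subtype.ext (Units.ext (congrArg Subtype.val huv))
  have hdvd : s ∣ Nat.card f.range := by
    refine orderOf_dvd_of_pow_eq_one (AddChar.ext _ _ fun g => ?_)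
    have h1 : (⟨f (Multiplicative.ofAdd g), ⟨_, rfl⟩⟩ : f.range) ^ Nat.card f.range = 1 :=
      pow_card_eq_one'
    have h2 := congrArg (fun u : f.range => ((u : ℂˣ) : ℂ)) h1
    exact h2
  have hroots : #(nthRootsFinset s (1 : ℂ)) = s :=
    (Complex.isPrimitiveRoot_exp s hs.ne').card_nthRootsFinset
  have himage : univ.image χ = nthRootsFinset s (1 : ℂ) := by
    refine eq_of_subset_of_card_le (image_subset_iff.2 fun g _ => hmaps g) ?_
    rw [hroots]
    exact (Nat.le_of_dvd Nat.card_pos hdvd).trans hcard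
  have hrange (ξ : ℂ) (hξ : ξ ∈ nthRootsFinset s (1 : ℂ)) : ∃ g, χ g = ξ := by
    simpa [← himage] using hξ
  have hfib (ξ : ℂ) (hξ : ξ ∈ nthRootsFinset s (1 : ℂ)) :
      #{g : G | χ g = ξ} = #{g : G | χ g = ζ} := by
    obtain ⟨a, rfl⟩ := hrange ξ hξ
    obtain ⟨b, rfl⟩ := hrange ζ ((mem_nthRootsFinset hs 1).2 hζ)
    refine card_equiv (Equiv.addRight (b - a)) fun g => ?_
    have ha := (χ.val_isUnit a).ne_zero
    have hb := (χ.val_isUnit b).ne_zero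
    simp only [mem_filter, mem_univ, true_and, Equiv.coe_addRight, AddChar.map_add_eq_mul,
      AddChar.map_sub_eq_div]
    field_simp
  have hsum := card_eq_sum_card_fiberwise (s := univ) (f := χ) (t := nthRootsFinset s (1 : ℂ))
    fun g _ => hmaps g
  rw [← card_univ, hsum, sum_congr rfl hfib, sum_const, hroots, smul_eq_mul, mul_comm]

lemma AddChar.prod_one_add_mul (χ : AddChar G ℂ) (z : ℂ) :
    ∏ g : G, (1 + χ g * z) = (1 - (-z) ^ orderOf χ) ^ (Fintype.card G / orderOf χ) := by
  classical
  have hs : 0 < orderOf χ := orderOf_pos χ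
  rw [← prod_fiberwise_of_maps_to (g := χ) (t := nthRootsFinset (orderOf χ) (1 : ℂ))]
  · have h := (Complex.isPrimitiveRoot_exp _ hs.ne').pow_sub_pow_eq_prod_sub_mul 1 (-z) hs
    rw [one_pow] at h
    rw [h, ← prod_pow]
    refine prod_congr rfl fun ζ hζ => ?_
    have hc := χ.card_fiber_mul_orderOf ((mem_nthRootsFinset hs 1).1 hζ)
    rw [← hc, Nat.mul_div_cancel _ hs, ← prod_const]
    refine prod_congr rfl fun g hg => ?_
    rw [(mem_filter.1 hg).2]
    ring
  · intro g _
    rw [mem_nthRootsFinset hs, ← AddChar.pow_apply, pow_orderOf_eq_one, AddChar.one_apply]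

lemma AddChar.prod_one_add_C_mul_X (χ : AddChar G ℂ) :
    ∏ g : G, (1 + C (χ g) * X) = expand ℂ (orderOf χ)
      (((1 + X) ^ (Fintype.card G / orderOf χ)).comp (C (-(-1) ^ orderOf χ) * X)) := by
  refine Polynomial.funext fun z => ?_
  rw [expand_eval, eval_prod]
  simp only [eval_add, eval_one, eval_mul, eval_C, eval_X, eval_comp, eval_pow]
  rw [χ.prod_one_add_mul, neg_pow z]
  ring

/-- The elementary symmetric functions of the values of a character. -/
lemma AddChar.sum_powersetCard_apply_sum (χ : AddChar G ℂ) (k : ℕ) :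
    ∑ T ∈ powersetCard k (univ : Finset G), χ (∑ t ∈ T, t)
      = if orderOf χ ∣ k then (-1 : ℂ) ^ (k + k / orderOf χ) *
        (Nat.choose (Fintype.card G / orderOf χ) (k / orderOf χ) : ℂ) else 0 := by
  classical
  have hs : 0 < orderOf χ := orderOf_pos χ
  have h := congrArg (fun p => coeff p k) χ.prod_one_add_C_mul_X
  simp only [coeff_expand hs, comp_C_mul_X_coeff, coeff_one_add_X_pow] at h
  have hl : (∏ g : G, (1 + C (χ g) * X)).coeff k
      = ∑ T ∈ powersetCard k (univ : Finset G), χ (∑ t ∈ T, t) := by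
    have hT (T : Finset G) : ∏ t ∈ T, (C (χ t) * X) = C (χ (∑ t ∈ T, t)) * X ^ #T := by
      rw [prod_mul_distrib, prod_const, ← map_prod]
      congr 2
      exact (map_prod χ.toMonoidHom (fun t => Multiplicative.ofAdd t) T).symm
    simp_rw [prod_one_add, hT, finsetSum_coeff, coeff_C_mul_X_pow]
    rw [← sum_filter, powersetCard_eq_filter]
    simp_rw [eq_comm]
  rw [← hl, h]
  refine if_ctx_congr Iff.rfl (fun hk => ?_) fun _ => rfl
  obtain ⟨j, rfl⟩ := hk
  rw [Nat.mul_div_cancel_left _ hs, neg_pow, ← pow_mul, pow_add]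
  ring

/-- Counting subsets with a given sum by means of the characters of the group. -/
lemma card_mul_card_subset_sum (x : G) (k : ℕ) :
    (Fintype.card G : ℂ) * (Nat.card {T : Finset G // #T = k ∧ ∑ t ∈ T, t = x} : ℂ)
      = ∑ χ : AddChar G ℂ,
        χ (-x) * ∑ T ∈ powersetCard k (univ : Finset G), χ (∑ t ∈ T, t) := by
  classical
  simp_rw [mul_sum, ← AddChar.map_add_eq_mul, neg_add_eq_sub]
  rw [sum_comm]
  simp_rw [AddChar.sum_apply_eq_ite, sub_eq_zero]
  rw [← sum_filter, sum_const, nsmul_eq_mul, mul_comm, Nat.card_eq_fintype_card,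
    Fintype.card_subtype, powersetCard_eq_filter, filter_filter, powerset_univ]

end SubsetSum

/-- Kosters' subset-sum formula in a finite abelian group (stated multiplied
through by n = |G|): n · b_k^x = Σ_{s | gcd(exp G, k)} (−1)^{k+k/s} C(n/s, k/s)
Σ_{d | gcd(e(x), s)} μ(s/d) |G[d]|, where e(x) = max{d : d | exp G, x ∈ dG}. -/
theorem stmt_9 (G : Type) [AddCommGroup G] [Fintype G] [DecidableEq G]
    (x : G) (k : ℕ) (hk1 : 1 ≤ k) (hkn : k ≤ Fintype.card G) :
    (Fintype.card G : ℤ) *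
        (Nat.card {T : Finset G // T.card = k ∧ ∑ t ∈ T, t = x} : ℤ)
      = ∑ s ∈ (Nat.gcd (AddMonoid.exponent G) k).divisors,
          (-1 : ℤ) ^ (k + k / s) * (Nat.choose (Fintype.card G / s) (k / s) : ℤ) *
            ∑ d ∈ (Nat.gcd
                (((AddMonoid.exponent G).divisors.filter
                  (fun d => ∃ g : G, d • g = x)).sup id) s).divisors,
              ArithmeticFunction.moebius (s / d) *
                (Nat.card {g : G // d • g = 0} : ℤ) := by
  classical
  have hN : AddMonoid.exponent G ≠ 0 := AddMonoid.exponent_ne_zero_of_finite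
  set N := AddMonoid.exponent G
  rw [← Int.cast_inj (α := ℂ)]
  push_cast
  rw [card_mul_card_subset_sum,
    ← sum_fiberwise_of_maps_to (g := orderOf) (t := N.divisors)
      fun χ _ => Nat.mem_divisors.2 ⟨χ.orderOf_dvd_exponent, hN⟩]
  have hfilter : (N.gcd k).divisors = N.divisors.filter (· ∣ k) := by
    ext s
    simp [Nat.dvd_gcd_iff, hN, Nat.gcd_eq_zero_iff]
  rw [hfilter, sum_filter]
  refine sum_congr rfl fun s hs => ?_
  have hsN := Nat.dvd_of_mem_divisors hs
  have hspos := Nat.pos_of_mem_divisors hs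
  have hfiber : ∑ χ : AddChar G ℂ with orderOf χ = s,
      χ (-x) * ∑ T ∈ powersetCard k (univ : Finset G), χ (∑ t ∈ T, t)
      = (∑ χ : AddChar G ℂ with orderOf χ = s, χ (-x)) * if s ∣ k then
        (-1 : ℂ) ^ (k + k / s) * (Nat.choose (Fintype.card G / s) (k / s) : ℂ) else 0 := by
    rw [sum_mul]
    refine sum_congr rfl fun χ hχ => ?_
    rw [χ.sum_powersetCard_apply_sum, (mem_filter.1 hχ).2]
  rw [hfiber, AddChar.sum_filter_orderOf_eq_apply_neg hspos]
  split_ifs with hk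
  · rw [mul_comm]
    congr 1
    set e := (N.divisors.filter (fun d => ∃ g : G, d • g = x)).sup id
    have hdiv : (e.gcd s).divisors = s.divisors.filter (· ∣ e) := by
      ext d
      simp [Nat.dvd_gcd_iff, hspos.ne', Nat.gcd_eq_zero_iff, and_comm]
    rw [hdiv, sum_filter]
    refine sum_congr rfl fun d hd => ?_
    have hdN := (Nat.dvd_of_mem_divisors hd).trans hsN
    rw [if_congr (dvd_sup_divisors_filter_iff hN hdN x) rfl rfl]
    split_ifs with hx
    · obtain ⟨g, hg⟩ := hx
      rw [card_nsmul_eq d hg]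
    · have : IsEmpty {g : G // d • g = x} := ⟨fun g => hx ⟨g.1, g.2⟩⟩
      simp
  · simp
end
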